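/- arXiv:1204.5807 — 5 statements merged into one kernel-verified Lean document; each statement's English description precedes it below -/
import Mathlib

section
/- Let H be an algebra over a field k and ω ∈ H a unit. If the trace condition for ω (tr(ϑ ∘ ρ_M(ω)) = tr(ϑ ∘ ρ_M(ω⁻¹)) for every H-linear endomorphism ϑ) holds for every finite-dimensional semisimple H-module, then it holds for every finite-dimensional H-module. -/
/-- The action of `h : H` as a `k`-linear endomorphism of the `H`-module `V`. -/
def rho (k : Type*) {H V : Type*} [CommSemiring k] [Semiring H] [Algebra k H]
    [AddCommMonoid V] [Module k V] [Module H V] [IsScalarTower k H V] (h : H) :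
    Module.End k V where
  toFun v := h • v
  map_add' x y := smul_add h x y
  map_smul' c v := (smul_comm c h v).symm

/-- The trace condition for the unit `ω` on the module `V`. -/
def TraceCond (k : Type*) (H : Type*) [CommSemiring k] [Semiring H] [Algebra k H] (ω : Hˣ)
    (V : Type*) [AddCommGroup V] [Module k V] [Module H V] [IsScalarTower k H V] : Prop :=
  ∀ ϑ : Module.End k V, (∀ (h : H) (v : V), ϑ (h • v) = h • ϑ v) →
    LinearMap.trace k V (ϑ ∘ₗ rho k (ω : H)) = LinearMap.trace k V (ϑ ∘ₗ rho k ((ω⁻¹ : Hˣ) : H))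

theorem LinearMap.trace_eq_add_of_exact {k V M Q : Type*} [Field k] [AddCommGroup V] [Module k V]
    [AddCommGroup M] [Module k M] [AddCommGroup Q] [Module k Q] [FiniteDimensional k V]
    [FiniteDimensional k M] [FiniteDimensional k Q] {i : V →ₗ[k] M} {p : M →ₗ[k] Q}
    (hi : Function.Injective i) (hp : Function.Surjective p) (hip : Function.Exact i p)
    {a : Module.End k V} {f : Module.End k M} {b : Module.End k Q}
    (ha : f ∘ₗ i = i ∘ₗ a) (hb : p ∘ₗ f = b ∘ₗ p) :
    LinearMap.trace k M f = LinearMap.trace k V a + LinearMap.trace k Q b := by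
  obtain ⟨r, hr⟩ := i.exists_leftInverse_of_injective (LinearMap.ker_eq_bot.2 hi)
  obtain ⟨s, hs⟩ := p.exists_rightInverse_of_surjective (LinearMap.range_eq_top.2 hp)
  have hr' (x : V) : r (i x) = x := LinearMap.congr_fun hr x
  have hs' (y : Q) : p (s y) = y := LinearMap.congr_fun hs y
  have hb' (x : M) : p (f x) = b (p x) := LinearMap.congr_fun hb x
  have hg : f = (f ∘ₗ i) ∘ₗ r + ((f - (f ∘ₗ i) ∘ₗ r) ∘ₗ s) ∘ₗ p := by
    ext x
    obtain ⟨y, hy⟩ := (hip (x - s (p x))).1 (by simp [hs'])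
    have hx : f x = f (i y) + f (s (p x)) := by rw [← map_add, hy, sub_add_cancel]
    have hrx : r x = y + r (s (p x)) := by rw [← hr' y, ← map_add, hy, sub_add_cancel]
    simp [hx, hrx]
  have h₁ : r ∘ₗ (f ∘ₗ i) = a := by rw [ha, ← LinearMap.comp_assoc, hr, LinearMap.id_comp]
  have h₂ : p ∘ₗ ((f - (f ∘ₗ i) ∘ₗ r) ∘ₗ s) = b := by
    ext y
    simp [hb', hs', hip.apply_apply_eq_zero]
  rw [hg, map_add, LinearMap.trace_comp_comm' r, LinearMap.trace_comp_comm' p, h₁, h₂]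

/-- The socle of a module, the sum of its simple submodules, is fully invariant. -/
theorem isFullyInvariant_sSup_simples (R M : Type*) [Ring R] [AddCommGroup M] [Module R M] :
    (sSup {m : Submodule R M | IsSimpleModule R m}).IsFullyInvariant := by
  intro T
  refine sSup_le fun m hm ↦ ?_
  have : IsSimpleModule R m := hm
  rw [← Submodule.map_le_iff_le_comap]
  obtain hT | hT := (T ∘ₗ m.subtype).injective_or_eq_zero
  · refine le_sSup ?_
    have := IsSimpleModule.congr (LinearEquiv.ofInjective _ hT).symm
    rwa [LinearMap.range_comp, Submodule.range_subtype] at this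
  · rw [← m.range_subtype, ← LinearMap.range_comp, hT, LinearMap.range_zero]
    exact bot_le

/-- The trace condition can be checked on a fully invariant submodule and its quotient. -/
theorem TraceCond.of_isFullyInvariant {k H M : Type*} [Field k] [Ring H] [Algebra k H] {ω : Hˣ}
    [AddCommGroup M] [Module k M] [Module H M] [IsScalarTower k H M] [FiniteDimensional k M]
    {S : Submodule H M} (hS : S.IsFullyInvariant) [FiniteDimensional k S]
    [FiniteDimensional k (M ⧸ S)] (h₁ : TraceCond k H ω S) (h₂ : TraceCond k H ω (M ⧸ S)) :
    TraceCond k H ω M := by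
  intro ϑ hϑ
  let T : Module.End H M := { ϑ with map_smul' := hϑ }
  let A : Module.End k S := (T.restrict (hS T)).restrictScalars k
  let B : Module.End k (M ⧸ S) := (S.mapQ S T (hS T)).restrictScalars k
  have key (h : H) : LinearMap.trace k M (ϑ ∘ₗ rho k h) =
      LinearMap.trace k S (A ∘ₗ rho k h) + LinearMap.trace k (M ⧸ S) (B ∘ₗ rho k h) :=
    LinearMap.trace_eq_add_of_exact (i := S.subtype.restrictScalars k)
      (p := S.mkQ.restrictScalars k) S.subtype_injective S.mkQ_surjective
      (LinearMap.exact_subtype_mkQ S) rfl rfl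
  rw [key, key, h₁ A fun h v ↦ map_smul (T.restrict (hS T)) h v,
    h₂ B fun h v ↦ map_smul (S.mapQ S T (hS T)) h v]

theorem stmt2 (k H : Type) [Field k] [Ring H] [Algebra k H] (ω : Hˣ)
    (hss : ∀ (V : Type) [AddCommGroup V] [Module k V] [Module H V] [IsScalarTower k H V]
        [FiniteDimensional k V], IsSemisimpleModule H V → TraceCond k H ω V) :
    ∀ (M : Type) [AddCommGroup M] [Module k M] [Module H M] [IsScalarTower k H M]
        [FiniteDimensional k M], TraceCond k H ω M := by
  intro M _ _ _ _ _
  induction hn : Module.finrank k M using Nat.strong_induction_on generalizing M with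
  | _ n ih =>
  subst hn
  by_cases hM : IsSemisimpleModule H M
  · exact hss M hM
  have : IsArtinian H M := isArtinian_of_tower k inferInstance
  let S : Submodule H M := sSup {m : Submodule H M | IsSimpleModule H m}
  have hS_top : S ≠ ⊤ := fun h ↦ hM (.of_sSup_simples_eq_top h)
  have hS_bot : S ≠ ⊥ := by
    have : Nontrivial M := not_subsingleton_iff_nontrivial.1 fun _ ↦
      hM (.of_sSup_simples_eq_top (Subsingleton.elim _ _))
    obtain ⟨m, hm⟩ := IsAtomic.exists_atom (Submodule H M)
    exact ne_bot_of_le_ne_bot hm.1 (le_sSup (isSimpleModule_iff_isAtom.2 hm))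
  have : FiniteDimensional k S :=
    inferInstanceAs (FiniteDimensional k (S.restrictScalars k))
  have : FiniteDimensional k (M ⧸ S) :=
    .of_surjective (S.mkQ.restrictScalars k) S.mkQ_surjective
  have h_add : Module.finrank k (M ⧸ S) + Module.finrank k S = Module.finrank k M :=
    (S.restrictScalars k).finrank_quotient_add_finrank
  have : Nontrivial S := Submodule.nontrivial_iff_ne_bot.2 hS_bot
  have : Nontrivial (M ⧸ S) := Submodule.Quotient.nontrivial_iff.2 hS_top
  have h_sub : 0 < Module.finrank k S := Module.finrank_pos
  have h_quot : 0 < Module.finrank k (M ⧸ S) := Module.finrank_pos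
  exact .of_isFullyInvariant (isFullyInvariant_sSup_simples H M)
    (ih _ (by omega) S rfl) (ih _ (by omega) (M ⧸ S) rfl)
end

section
/- Let k be an algebraically closed field of characteristic 0, H an algebra over k, and ω ∈ H. Let V and W be finite-dimensional indecomposable H-modules with tr(ρ_V(ω)) ≠ 0 and tr(ρ_W(ω)) ≠ 0. Suppose there exist H-linear maps f : V → W and g : W → V such that tr((g∘f − id_V) ∘ ρ_V(ω)) = 0. Then f and g are isomorphisms; in particular V ≅ W as H-modules. -/
/-- An `H`-module is indecomposable if it is nonzero and is not the (internal) direct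
sum of two nonzero submodules. -/
def IsIndecomposable (H V : Type*) [Ring H] [AddCommGroup V] [Module H V] : Prop :=
  Nontrivial V ∧ ∀ W₁ W₂ : Submodule H V, IsCompl W₁ W₂ → W₁ = ⊥ ∨ W₂ = ⊥

/-- **Fitting's lemma**: an endomorphism of an indecomposable module of finite length is
nilpotent or bijective. -/
theorem IsIndecomposable.isNilpotent_or_bijective {H V : Type*} [Ring H] [AddCommGroup V]
    [Module H V] [IsNoetherian H V] [IsArtinian H V] (hV : IsIndecomposable H V)
    (φ : Module.End H V) : IsNilpotent φ ∨ Function.Bijective φ := by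
  obtain ⟨n, hn, hn_pos⟩ := (φ.eventually_isCompl_ker_pow_range_pow.and
    (Filter.eventually_ge_atTop 1)).exists
  rcases hV.2 _ _ hn with hker | hrange
  · right
    have hinj : Function.Injective φ := by
      rw [← LinearMap.ker_eq_bot, eq_bot_iff, ← hker]
      intro x hx
      obtain ⟨m, rfl⟩ := Nat.exists_eq_add_of_le' hn_pos
      rw [LinearMap.mem_ker] at hx ⊢
      rw [pow_succ, Module.End.mul_apply, hx, map_zero]
    exact IsArtinian.bijective_of_injective_endomorphism φ hinj
  · exact .inl ⟨n, LinearMap.range_eq_bot.mp hrange⟩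

/-- A linear map into an indecomposable module is bijective if it is a split injection
up to an automorphism of its nonzero source. -/
theorem IsIndecomposable.bijective_of_bijective_comp {H V W : Type*} [Ring H]
    [AddCommGroup V] [Module H V] [AddCommGroup W] [Module H W] [Nontrivial V]
    (hW : IsIndecomposable H W) (f : V →ₗ[H] W) (g : W →ₗ[H] V)
    (hgf : Function.Bijective (g ∘ₗ f)) : Function.Bijective f := by
  have hinj : Function.Injective f := Function.Injective.of_comp (f := g) hgf.1
  have hcompl : IsCompl (LinearMap.range f) (LinearMap.ker g) := by
    constructor
    · rw [Submodule.disjoint_def]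
      rintro _ ⟨v, rfl⟩ hv
      have hv0 : v = 0 := hgf.1 (by simpa using hv)
      rw [hv0, map_zero]
    · rw [codisjoint_iff, eq_top_iff]
      intro w _
      obtain ⟨v, hv⟩ := hgf.2 (g w)
      refine Submodule.mem_sup.mpr ⟨f v, ⟨v, rfl⟩, w - f v, ?_, by abel⟩
      rw [LinearMap.mem_ker, map_sub, sub_eq_zero]
      exact hv.symm
  refine ⟨hinj, ?_⟩
  rcases hW.2 _ _ hcompl with hrange | hker
  · obtain ⟨v, hv⟩ := exists_ne (0 : V)
    refine absurd (hinj ?_) hv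
    rw [LinearMap.range_eq_bot.mp hrange, LinearMap.zero_apply, LinearMap.zero_apply]
  · rw [← LinearMap.range_eq_top]
    simpa [hker] using hcompl.sup_eq_top

/-- A nilpotent `H`-linear endomorphism composed with the action of an element of `H`
has trace zero. -/
theorem trace_comp_rho_eq_zero {k H V : Type*} [Field k] [Ring H] [Algebra k H]
    [AddCommGroup V] [Module k V] [Module H V] [IsScalarTower k H V] (ω : H)
    {φ : Module.End H V} (hφ : IsNilpotent φ) :
    LinearMap.trace k V (φ.restrictScalars k ∘ₗ rho k ω) = 0 := by
  obtain ⟨n, hn⟩ := hφ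
  have hpow (m : ℕ) (v : V) :
      (((φ.restrictScalars k : Module.End k V)) ^ m) v = (φ ^ m) v := by
    induction m generalizing v with
    | zero => rfl
    | succ m ih => rw [pow_succ, pow_succ, Module.End.mul_apply, Module.End.mul_apply, ih]; rfl
  have hnil : IsNilpotent (φ.restrictScalars k : Module.End k V) :=
    ⟨n, LinearMap.ext fun v => by rw [hpow, hn]; rfl⟩
  have hcomm : Commute (φ.restrictScalars k : Module.End k V) (rho k ω) :=
    LinearMap.ext fun v => φ.map_smul ω v
  exact (LinearMap.isNilpotent_trace_of_isNilpotent (hcomm.isNilpotent_mul_right hnil)).eq_zero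

theorem stmt10 (k H V W : Type) [Field k] [IsAlgClosed k] [CharZero k] [Ring H] [Algebra k H]
    [AddCommGroup V] [Module k V] [Module H V] [IsScalarTower k H V] [FiniteDimensional k V]
    [AddCommGroup W] [Module k W] [Module H W] [IsScalarTower k H W] [FiniteDimensional k W]
    (hV : IsIndecomposable H V) (hW : IsIndecomposable H W) (ω : H)
    (htrV : LinearMap.trace k V (rho k ω) ≠ 0)
    (htrW : LinearMap.trace k W (rho k ω) ≠ 0)
    (f : V →ₗ[H] W) (g : W →ₗ[H] V)
    (h : LinearMap.trace k V
      ((((g ∘ₗ f) - LinearMap.id).restrictScalars k) ∘ₗ rho k ω) = 0) :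
    Function.Bijective f ∧ Function.Bijective g ∧ Nonempty (V ≃ₗ[H] W) := by
  have : IsNoetherian H V := isNoetherian_of_tower k inferInstance
  have : IsArtinian H V := isArtinian_of_tower k inferInstance
  have : Nontrivial V := hV.1
  have hgf : Function.Bijective (g ∘ₗ f) := by
    refine (hV.isNilpotent_or_bijective (g ∘ₗ f)).resolve_left fun hnil => htrV ?_
    have hsub : ((g ∘ₗ f - LinearMap.id).restrictScalars k) ∘ₗ rho k ω =
        (g ∘ₗ f).restrictScalars k ∘ₗ rho k ω - rho k ω := rfl
    rw [hsub, map_sub, trace_comp_rho_eq_zero ω hnil, zero_sub, neg_eq_zero] at h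
    exact h
  have hf : Function.Bijective f := hW.bijective_of_bijective_comp f g hgf
  have hg : Function.Bijective g := (Function.Bijective.of_comp_iff g hf).mp hgf
  exact ⟨hf, hg, ⟨LinearEquiv.ofBijective f hf⟩⟩
end

section
/- Let C be a preadditive category with binary biproducts in which the endomorphism ring End(X) of every object X is a semisimple ring. If α : V → W is a nonzero morphism, then there exist morphisms β : W → V and γ : W → V such that β∘α ≠ 0 and α∘γ ≠ 0. Consequently, if Hom(V, W) = 0 then Hom(W, V) = 0. -/
open CategoryTheory Limits

/-- Semisimple rings are von Neumann regular. -/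
theorem IsSemisimpleRing.exists_mul_mul_eq_self {R : Type*} [Ring R] [IsSemisimpleRing R]
    (a : R) : ∃ b, a * b * a = a := by
  obtain ⟨J, hJ⟩ := exists_isCompl (Ideal.span {a})
  obtain ⟨e, he, j, hj, hej⟩ := Submodule.mem_sup.1 (hJ.sup_eq_top ▸ Submodule.mem_top :
    (1 : R) ∈ Ideal.span {a} ⊔ J)
  obtain ⟨b, rfl⟩ := Ideal.mem_span_singleton'.1 he
  have hsum : a * (b * a) + a * j = a := by rw [← mul_add, hej, mul_one]
  have hmem : a * j ∈ Ideal.span {a} := by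
    rw [eq_sub_of_add_eq' hsum]
    exact sub_mem (Ideal.mem_span_singleton_self a) (Ideal.mul_mem_left _ _ he)
  have hzero : a * j = 0 :=
    Submodule.disjoint_def.1 hJ.disjoint _ hmem (Ideal.mul_mem_left _ _ hj)
  exact ⟨b, by rwa [hzero, add_zero, ← mul_assoc] at hsum⟩

/-- Every morphism `α : V ⟶ W` has a generalized inverse if `End (V ⊞ W)` is semisimple. -/
theorem CategoryTheory.exists_comp_comp_eq_self_of_isSemisimpleRing_end {C : Type*} [Category C]
    [Preadditive C] {V W : C} [HasBinaryBiproduct V W] [IsSemisimpleRing (End (V ⊞ W))]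
    (α : V ⟶ W) : ∃ β : W ⟶ V, α ≫ β ≫ α = α := by
  let a : V ⊞ W ⟶ V ⊞ W := biprod.fst ≫ α ≫ biprod.inr
  obtain ⟨b, hb⟩ := IsSemisimpleRing.exists_mul_mul_eq_self (R := End (V ⊞ W)) a
  let b' : V ⊞ W ⟶ V ⊞ W := b
  have hab : a ≫ b' ≫ a = a := hb
  refine ⟨biprod.inr ≫ b' ≫ biprod.fst, ?_⟩
  simpa [a] using congrArg (fun f => biprod.inl ≫ f ≫ biprod.snd) hab

theorem stmt11 (C : Type*) [Category C] [Preadditive C] [HasBinaryBiproducts C]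
    (hss : ∀ X : C, IsSemisimpleRing (End X)) :
    (∀ (V W : C) (α : V ⟶ W), α ≠ 0 →
      ∃ (β γ : W ⟶ V), α ≫ β ≠ 0 ∧ γ ≫ α ≠ 0) ∧
    (∀ V W : C, (∀ α : V ⟶ W, α = 0) → ∀ β : W ⟶ V, β = 0) := by
  have key {V W : C} (α : V ⟶ W) : ∃ β : W ⟶ V, α ≫ β ≫ α = α :=
    exists_comp_comp_eq_self_of_isSemisimpleRing_end α
  refine ⟨fun V W α hα => ?_, fun V W h β => ?_⟩
  · obtain ⟨β, hβ⟩ := key α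
    refine ⟨β, β, fun h => hα ?_, fun h => hα ?_⟩
    · rw [← hβ, ← Category.assoc, h, zero_comp]
    · rw [← hβ, h, comp_zero]
  · obtain ⟨α, hα⟩ := key β
    rw [← hα, h α, zero_comp, comp_zero]
end

section
/- Let H be a Hopf algebra over a field k with antipode S, and let t, t′ : H → k be algebra homomorphisms that are convolution inverse to each other, i.e., in Sweedler notation t(x₁)t′(x₂) = ε(x) = t′(x₁)t(x₂) for all x ∈ H. Assume t is a copivot: S²(x₁)t(x₂) = t(x₁)x₂ for all x ∈ H. Then the antipode S is bijective, with inverse given by S⁻¹(x) = t′(x₁) S(x₂) t(x₃); that is, the linear map T : H → H defined as the composite of (Δ ⊗ id)∘Δ with x₁ ⊗ x₂ ⊗ x₃ ↦ t′(x₁)t(x₃)·S(x₂) satisfies T∘S = id_H = S∘T. -/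
open scoped TensorProduct

/-- The linear map `x ↦ t′(x₁) S(x₂) t(x₃)`, built from two applications of the
comultiplication, the antipode in the middle slot and the functionals `t′`, `t` in
the outer slots. -/
noncomputable def Tmap (k H : Type*) [CommRing k] [Ring H] [HopfAlgebra k H]
    (t t' : H →ₐ[k] k) : H →ₗ[k] H :=
  (TensorProduct.lid k H).toLinearMap ∘ₗ
    (TensorProduct.rid k (k ⊗[k] H)).toLinearMap ∘ₗ
      (TensorProduct.map
        (TensorProduct.map t'.toLinearMap (HopfAlgebra.antipode (R := k))) t.toLinearMap) ∘ₗ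
        (TensorProduct.map (Coalgebra.comul (R := k)) LinearMap.id) ∘ₗ
          (Coalgebra.comul (R := k))

open WithConv

section Convolution

variable {R C A B : Type*} [CommSemiring R] [AddCommMonoid C] [Module R C]
  [Semiring A] [Algebra R A] [Semiring B] [Algebra R B]

/-- A functional on a coalgebra, regarded as an element of the convolution algebra of
linear maps into an algebra. -/
def scalarConv (A : Type*) [Semiring A] [Algebra R A] (φ : C →ₗ[R] R) : WithConv (C →ₗ[R] A) :=
  toConv (Algebra.linearMap R A ∘ₗ φ)

theorem scalarConv_apply (φ : C →ₗ[R] R) (c : C) :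
    scalarConv A φ c = algebraMap R A (φ c) := rfl

variable [Coalgebra R C]

theorem scalarConv_mul_apply (φ : C →ₗ[R] R) (f : WithConv (C →ₗ[R] A)) (c : C) :
    (scalarConv A φ * f) c =
      TensorProduct.lid R A (TensorProduct.map φ f.ofConv (Coalgebra.comul c)) := by
  obtain r := Coalgebra.Repr.arbitrary R c
  rw [r.convMul_apply, ← r.eq]
  simp [scalarConv_apply, Algebra.smul_def]

theorem mul_scalarConv_apply (f : WithConv (C →ₗ[R] A)) (φ : C →ₗ[R] R) (c : C) :
    (f * scalarConv A φ) c =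
      TensorProduct.rid R A (TensorProduct.map f.ofConv φ (Coalgebra.comul c)) := by
  obtain r := Coalgebra.Repr.arbitrary R c
  rw [r.convMul_apply, ← r.eq]
  simp [scalarConv_apply, Algebra.smul_def, Algebra.commutes]

theorem comp_scalarConv_mul (g : A →ₗ[R] B) (φ : C →ₗ[R] R) (f : WithConv (C →ₗ[R] A)) :
    toConv (g ∘ₗ (scalarConv A φ * f).ofConv) = scalarConv B φ * toConv (g ∘ₗ f.ofConv) := by
  ext c
  change g ((scalarConv A φ * f) c) = (scalarConv B φ * toConv (g ∘ₗ f.ofConv)) c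
  obtain r := Coalgebra.Repr.arbitrary R c
  rw [r.convMul_apply, r.convMul_apply]
  simp [scalarConv_apply, ← Algebra.smul_def]

theorem comp_mul_scalarConv (g : A →ₗ[R] B) (f : WithConv (C →ₗ[R] A)) (φ : C →ₗ[R] R) :
    toConv (g ∘ₗ (f * scalarConv A φ).ofConv) = toConv (g ∘ₗ f.ofConv) * scalarConv B φ := by
  ext c
  change g ((f * scalarConv A φ) c) = (toConv (g ∘ₗ f.ofConv) * scalarConv B φ) c
  obtain r := Coalgebra.Repr.arbitrary R c
  rw [r.convMul_apply, r.convMul_apply]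
  simp [scalarConv_apply, ← Algebra.commutes, ← Algebra.smul_def]

theorem scalarConv_mul_scalarConv_eq_one {φ ψ : C →ₗ[R] R}
    (h : LinearMap.mul' R R ∘ₗ TensorProduct.map φ ψ ∘ₗ Coalgebra.comul = Coalgebra.counit) :
    scalarConv A φ * scalarConv A ψ = 1 := by
  ext c
  change (scalarConv A φ * scalarConv A ψ) c = algebraMap R A (Coalgebra.counit c)
  obtain r := Coalgebra.Repr.arbitrary R c
  rw [r.convMul_apply, ← h]
  simp [← r.eq, scalarConv_apply]

end Convolution

theorem toConv_Tmap {k H : Type*} [CommRing k] [Ring H] [HopfAlgebra k H] (t t' : H →ₐ[k] k) :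
    toConv (Tmap k H t t') = scalarConv H t'.toLinearMap *
      toConv (HopfAlgebra.antipode k) * scalarConv H t.toLinearMap := by
  ext x
  change Tmap k H t t' x = (_ * scalarConv H t.toLinearMap) x
  obtain r := Coalgebra.Repr.arbitrary k x
  rw [r.convMul_apply]
  simp only [Tmap, LinearMap.comp_apply, ← r.eq, map_sum, TensorProduct.map_tmul,
    scalarConv_mul_apply, scalarConv_apply]
  simp [Algebra.smul_def, Algebra.commutes]

theorem stmt14 (k H : Type) [Field k] [Ring H] [HopfAlgebra k H]
    (t t' : H →ₐ[k] k)
    -- `t` and `t′` are convolution inverse to each other: `t(x₁)t′(x₂) = ε(x) = t′(x₁)t(x₂)`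
    (hconv₁ : (LinearMap.mul' k k) ∘ₗ (TensorProduct.map t.toLinearMap t'.toLinearMap) ∘ₗ
        Coalgebra.comul (R := k) = Coalgebra.counit (R := k) (A := H))
    (hconv₂ : (LinearMap.mul' k k) ∘ₗ (TensorProduct.map t'.toLinearMap t.toLinearMap) ∘ₗ
        Coalgebra.comul (R := k) = Coalgebra.counit (R := k) (A := H))
    -- `t` is a copivot: `S²(x₁)t(x₂) = t(x₁)x₂`
    (hcop : (TensorProduct.rid k H).toLinearMap ∘ₗ
        (TensorProduct.map
          ((HopfAlgebra.antipode (R := k)) ∘ₗ (HopfAlgebra.antipode (R := k) (A := H)))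
          t.toLinearMap) ∘ₗ Coalgebra.comul (R := k) =
      (TensorProduct.lid k H).toLinearMap ∘ₗ
        (TensorProduct.map t.toLinearMap (LinearMap.id (M := H))) ∘ₗ
          Coalgebra.comul (R := k)) :
    Tmap k H t t' ∘ₗ HopfAlgebra.antipode (R := k) = LinearMap.id ∧
    HopfAlgebra.antipode (R := k) ∘ₗ Tmap k H t t' = LinearMap.id ∧
    Function.Bijective (HopfAlgebra.antipode (R := k) (A := H)) := by
  set S : H →ₗ[k] H := HopfAlgebra.antipode k
  set τ := scalarConv H t.toLinearMap
  set τ' := scalarConv H t'.toLinearMap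
  have hττ' : τ * τ' = 1 := scalarConv_mul_scalarConv_eq_one hconv₁
  have hτ'τ : τ' * τ = 1 := scalarConv_mul_scalarConv_eq_one hconv₂
  have hS : toConv (S ∘ₗ S) * τ = τ * toConv LinearMap.id := by
    ext x
    exact (mul_scalarConv_apply _ _ x).trans
      ((LinearMap.congr_fun hcop x).trans (scalarConv_mul_apply _ _ x).symm)
  have hST : S ∘ₗ Tmap k H t t' = LinearMap.id := by
    apply toConv_injective
    calc toConv (S ∘ₗ Tmap k H t t')
        = toConv (S ∘ₗ (τ' * toConv S * τ).ofConv) := by rw [← toConv_Tmap]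
      _ = τ' * (toConv (S ∘ₗ S) * τ) := by
        rw [comp_mul_scalarConv, comp_scalarConv_mul, mul_assoc]
      _ = toConv LinearMap.id := by rw [hS, ← mul_assoc, hτ'τ, one_mul]
  have hSS : S ∘ₗ S = (τ * toConv LinearMap.id).ofConv ∘ₗ (toConv LinearMap.id * τ').ofConv := by
    apply toConv_injective
    rw [comp_mul_scalarConv]
    change _ = τ * toConv LinearMap.id * τ'
    rw [← hS, mul_assoc, hττ', mul_one]
  have hleft : (τ' * toConv LinearMap.id).ofConv ∘ₗ (τ * toConv LinearMap.id).ofConv =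
      LinearMap.id := by
    apply toConv_injective
    rw [comp_scalarConv_mul]
    change τ * (τ' * toConv LinearMap.id) = _
    rw [← mul_assoc, hττ', one_mul]
  have hright : (toConv LinearMap.id * τ).ofConv ∘ₗ (toConv LinearMap.id * τ').ofConv =
      LinearMap.id := by
    apply toConv_injective
    rw [comp_mul_scalarConv]
    change toConv LinearMap.id * τ * τ' = _
    rw [mul_assoc, hττ', mul_one]
  have hinj : Function.Injective S := by
    refine Function.Injective.of_comp (f := S) ?_
    rw [← LinearMap.coe_comp, hSS, LinearMap.coe_comp]
    exact (LinearMap.injective_of_comp_eq_id _ _ hleft).comp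
      (LinearMap.injective_of_comp_eq_id _ _ hright)
  exact ⟨LinearMap.ext fun x => hinj (LinearMap.congr_fun hST (S x)), hST, hinj,
    fun x => ⟨Tmap k H t t' x, LinearMap.congr_fun hST x⟩⟩
end

section
/- Let H be a finite-dimensional Hopf algebra over a field k. If H has finite global dimension — i.e., there exists n such that every finite-dimensional H-module has projective dimension at most n — then H is a semisimple ring. -/
/-- `ProjDimLE H n M` means the `H`-module `M` admits a projective resolution
`0 → P_n → … → P_1 → P_0 → M → 0` of length `n`, i.e. has projective dimension at most `n`. -/
def ProjDimLE (H : Type) [Ring H] :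
    (n : ℕ) → (M : Type) → [AddCommGroup M] → [Module H M] → Prop
  | 0, M, _, _ => Module.Projective H M
  | (n + 1), M, _, _ =>
      ∃ (P : Type) (_ : AddCommGroup P) (_ : Module H P),
        Module.Projective H P ∧
          ∃ f : P →ₗ[H] M, Function.Surjective f ∧ ProjDimLE H n (LinearMap.ker f)

namespace HopfAlgebra

open Coalgebra TensorProduct

lemma _root_.Coalgebra.sum_counit_smul_right {R A ι : Type*} [CommSemiring R] [AddCommMonoid A]
    [Module R A] [Coalgebra R A] {a : A} (r : Repr R a ι) :
    ∑ i ∈ r.index, counit (R := R) (r.right i) • r.left i = a := by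
  simpa only [map_sum, TensorProduct.rid_tmul, one_smul]
    using congr(TensorProduct.rid R A $(sum_tmul_counit_eq (R := R) r))

section Twist

variable {k H Y : Type*} [Field k] [Ring H] [HopfAlgebra k H] [AddCommGroup Y] [Module k Y]

/-- The diagonal action `h · (a ⊗ y) = ∑ h₁ a ⊗ h₂ y` of `H` on `H ⊗ Y`, where `H` acts on `Y`
through `ρ`. -/
noncomputable def diagAction (ρ : H →ₐ[k] Module.End k Y) : H →ₗ[k] Module.End k (H ⊗[k] Y) :=
  TensorProduct.homTensorHomMap (.id k) H Y H Y ∘ₗ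
    TensorProduct.map (LinearMap.mul k H) ρ.toLinearMap ∘ₗ comul

/-- The map `a ⊗ y ↦ ∑ a₁ ⊗ S(a₂) y`, intertwining the diagonal action with the action on the
left tensor factor. -/
noncomputable def untwist (ρ : H →ₐ[k] Module.End k Y) : H ⊗[k] Y →ₗ[k] H ⊗[k] Y :=
  (TensorProduct.lift (ρ.toLinearMap ∘ₗ antipode k)).lTensor H ∘ₗ
    (TensorProduct.assoc k H H Y).toLinearMap ∘ₗ comul.rTensor Y

/-- The map `a ⊗ y ↦ ∑ a₁ ⊗ a₂ y`. -/
noncomputable def twist (ρ : H →ₐ[k] Module.End k Y) : H ⊗[k] Y →ₗ[k] H ⊗[k] Y :=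
  (TensorProduct.lift ρ.toLinearMap).lTensor H ∘ₗ
    (TensorProduct.assoc k H H Y).toLinearMap ∘ₗ comul.rTensor Y

variable (ρ : H →ₐ[k] Module.End k Y)

lemma diagAction_tmul {ι : Type*} {h : H} (r : Repr k h ι) (a : H) (y : Y) :
    diagAction ρ h (a ⊗ₜ y) = ∑ i ∈ r.index, (r.left i * a) ⊗ₜ ρ (r.right i) y := by
  simp [diagAction, ← r.eq]

lemma untwist_tmul {ι : Type*} {a : H} (r : Repr k a ι) (y : Y) :
    untwist ρ (a ⊗ₜ y) = ∑ i ∈ r.index, r.left i ⊗ₜ ρ (antipode k (r.right i)) y := by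
  simp [untwist, ← r.eq, TensorProduct.sum_tmul]

lemma twist_tmul {ι : Type*} {a : H} (r : Repr k a ι) (y : Y) :
    twist ρ (a ⊗ₜ y) = ∑ i ∈ r.index, r.left i ⊗ₜ ρ (r.right i) y := by
  simp [twist, ← r.eq, TensorProduct.sum_tmul]

lemma twist_untwist (t : H ⊗[k] Y) : twist ρ (untwist ρ t) = t := by
  induction t with
  | zero => simp
  | add s t hs ht => simp [hs, ht]
  | tmul a y =>
    let r := ℛ k a
    let L : H ⊗[k] (H ⊗[k] H) →ₗ[k] H ⊗[k] Y :=
      (LinearMap.applyₗ y ∘ₗ ρ.toLinearMap ∘ₗ LinearMap.mul' k H ∘ₗ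
        (antipode k).lTensor H).lTensor H
    have key := congrArg L (sum_tmul_tmul_eq r (fun i ↦ ℛ k (r.left i)) fun i ↦ ℛ k (r.right i))
    simp only [L, map_sum, LinearMap.lTensor_tmul, LinearMap.comp_apply, LinearMap.mul'_apply,
      LinearMap.applyₗ_apply_apply, AlgHom.toLinearMap_apply, map_mul, Module.End.mul_apply] at key
    rw [untwist_tmul ρ r, map_sum]
    simp only [twist_tmul ρ (ℛ k (r.left _))]
    rw [key]
    simp only [← TensorProduct.tmul_sum, ← Module.End.mul_apply, ← map_mul, ← LinearMap.sum_apply,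
      ← map_sum, sum_mul_antipode_eq_smul]
    simp only [map_smul, map_one, LinearMap.smul_apply, Module.End.one_apply]
    simp only [← TensorProduct.smul_tmul, ← TensorProduct.sum_tmul]
    rw [sum_counit_smul_right r]

lemma untwist_injective : Function.Injective (untwist ρ) :=
  Function.LeftInverse.injective (twist_untwist ρ)

lemma untwist_diagAction (h : H) (t : H ⊗[k] Y) :
    untwist ρ (diagAction ρ h t) = h • untwist ρ t := by
  induction t with
  | zero => simp
  | add s t hs ht => simp [hs, ht]
  | tmul a y =>
    let r := ℛ k h
    let s := ℛ k a
    let L : H ⊗[k] (H ⊗[k] H) →ₗ[k] H ⊗[k] Y := ∑ j ∈ s.index,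
      TensorProduct.map (LinearMap.mulRight k (s.left j))
        (LinearMap.applyₗ y ∘ₗ ρ.toLinearMap ∘ₗ LinearMap.mulLeft k (antipode k (s.right j)) ∘ₗ
          LinearMap.mul' k H ∘ₗ (antipode k).rTensor H)
    have key := congrArg L (sum_tmul_tmul_eq r (fun i ↦ ℛ k (r.left i)) fun i ↦ ℛ k (r.right i))
    simp only [L, map_sum, LinearMap.sum_apply, TensorProduct.map_tmul, LinearMap.comp_apply,
      LinearMap.rTensor_tmul, LinearMap.mul'_apply, LinearMap.applyₗ_apply_apply,
      LinearMap.mulRight_apply, LinearMap.mulLeft_apply, AlgHom.toLinearMap_apply] at key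
    rw [diagAction_tmul ρ r, map_sum, untwist_tmul ρ s, Finset.smul_sum]
    simp only [fun i ↦ untwist_tmul ρ ((ℛ k (r.left i)).mul s)]
    simp only [Repr.mul_index, Repr.mul_left, Repr.mul_right, Finset.sum_product,
      antipode_mul_antidistrib, ← Module.End.mul_apply, ← map_mul, mul_assoc]
    rw [key, Finset.sum_congr rfl fun _ _ ↦ Finset.sum_comm, Finset.sum_comm]
    refine Finset.sum_congr rfl fun j _ ↦ ?_
    simp only [← TensorProduct.tmul_sum, ← LinearMap.sum_apply, ← map_sum, ← Finset.mul_sum,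
      sum_antipode_mul_eq_smul]
    simp only [mul_smul_comm, mul_one, map_smul, LinearMap.smul_apply, ← TensorProduct.smul_tmul,
      ← smul_mul_assoc, ← TensorProduct.sum_tmul, ← Finset.sum_mul]
    rw [sum_counit_smul_right r, TensorProduct.smul_tmul', smul_eq_mul]

end Twist

section Integral

variable (k H : Type*) [Field k] [Ring H] [HopfAlgebra k H]

/-- The left action of a Hopf algebra on its linear dual, `(h · f) x = f (S(h) x)`. -/
noncomputable def dualAction : H →ₐ[k] Module.End k (Module.Dual k H) :=
  AlgHom.ofLinearMap
    ((LinearMap.llcomp k H H k).flip ∘ₗ LinearMap.mul k H ∘ₗ antipode k)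
    (by ext; simp)
    (fun a b ↦ by ext; simp [antipode_mul_antidistrib, mul_assoc])

variable {H} in
@[simp]
lemma dualAction_apply (h : H) (f : Module.Dual k H) (x : H) :
    dualAction k H h f x = f (antipode k h * x) := rfl

/-- A finite-dimensional Hopf algebra has a nonzero left integral. -/
theorem exists_left_integral [FiniteDimensional k H] :
    ∃ Λ : H, Λ ≠ 0 ∧ ∀ h : H, h * Λ = counit (R := k) h • Λ := by
  let j : H ⊗[k] Module.Dual k H ≃ₗ[k] Module.End k H :=
    TensorProduct.comm k H (Module.Dual k H) ≪≫ₗ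
      dualTensorHomEquiv k H H
  have hj (h : H) (t : H ⊗[k] Module.Dual k H) {ι : Type _} (r : Repr k h ι) :
      j (diagAction (dualAction k H) h t) = ∑ i ∈ r.index,
        LinearMap.mulLeft k (r.left i) ∘ₗ j t ∘ₗ LinearMap.mulLeft k (antipode k (r.right i)) := by
    induction t with
    | zero => simp
    | add s t hs ht =>
      simp only [map_add, hs, ht, LinearMap.add_comp, LinearMap.comp_add, Finset.sum_add_distrib]
    | tmul a f =>
      rw [diagAction_tmul _ r, map_sum]
      refine Finset.sum_congr rfl fun i _ ↦ ?_
      ext x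
      simp [j]
  have hcoev (h : H) : diagAction (dualAction k H) h (j.symm 1) =
      counit (R := k) h • j.symm 1 := by
    apply j.injective
    rw [hj h _ (ℛ k h), map_smul, j.apply_symm_apply]
    ext x
    simp [← mul_assoc, ← Finset.sum_mul, sum_mul_antipode_eq_smul]
  have : Nontrivial H := (Bialgebra.counitAlgHom k H).toRingHom.domain_nontrivial
  have hne : untwist (dualAction k H) (j.symm 1) ≠ 0 := by
    rw [Ne, map_eq_zero_iff _ (untwist_injective _), LinearEquiv.map_eq_zero_iff]
    exact one_ne_zero
  let b := Algebra.TensorProduct.basis H (Module.finBasis k (Module.Dual k H))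
  obtain ⟨i, hi⟩ : ∃ i, b.repr (untwist (dualAction k H) (j.symm 1)) i ≠ 0 := by
    by_contra! h
    exact hne (b.repr.map_eq_zero_iff.1 (Finsupp.ext h))
  refine ⟨_, hi, fun h ↦ ?_⟩
  rw [← smul_eq_mul, ← Finsupp.smul_apply, ← map_smul, ← untwist_diagAction, hcoev, map_smul,
    ← algebraMap_smul H (counit h : k), map_smul, Finsupp.smul_apply, algebraMap_smul]

variable {k H}

/-- A nonzero left integral `Λ` of `H` embeds every `H`-module `X` into the free module `H ⊗ X`,
by `x ↦ ∑ Λ₁ ⊗ S(Λ₂) x`. -/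
theorem exists_injective_to_tensor [FiniteDimensional k H] (X : Type*) [AddCommGroup X]
    [Module k X] [Module H X] [IsScalarTower k H X] :
    ∃ f : X →ₗ[H] H ⊗[k] X, Function.Injective f := by
  obtain ⟨Λ, hΛ, hint⟩ := exists_left_integral k H
  let ρ : H →ₐ[k] Module.End k X := Algebra.lsmul k k X
  have hdiag (h : H) (x : X) : diagAction ρ h (Λ ⊗ₜ x) = Λ ⊗ₜ (h • x) := by
    rw [diagAction_tmul ρ (ℛ k h)]
    simp only [hint, TensorProduct.smul_tmul, ← TensorProduct.tmul_sum]
    conv_rhs => rw [← sum_counit_smul (R := k) (ℛ k h), Finset.sum_smul]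
    simp [ρ]
  refine ⟨{ toFun x := untwist ρ (Λ ⊗ₜ x)
            map_add' x y := by rw [TensorProduct.tmul_add, map_add]
            map_smul' h x := by rw [← hdiag, untwist_diagAction, RingHom.id_apply] }, ?_⟩
  obtain ⟨φ, hφ⟩ : ∃ φ : Module.Dual k H, φ Λ ≠ 0 :=
    Module.Projective.exists_dual_ne_zero k hΛ
  intro x y hxy
  have := congr(TensorProduct.lid k X (φ.rTensor X $(untwist_injective ρ hxy)))
  simpa [hφ] using this

end Integral
end HopfAlgebra

open CategoryTheory TensorProduct

lemma ProjDimLE.hasProjectiveDimensionLE {H : Type} [Ring H] {n : ℕ} {M : Type} [AddCommGroup M]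
    [Module H M] (h : ProjDimLE H n M) : HasProjectiveDimensionLE (ModuleCat.of H M) n := by
  induction n generalizing M with
  | zero =>
    rw [← projective_iff_hasProjectiveDimensionLE_zero, ← IsProjective.iff_projective]
    exact h
  | succ n ih =>
    obtain ⟨P, _, _, hP, f, hf, hker⟩ := h
    have : Projective (ModuleCat.of H P) := (IsProjective.iff_projective P).1 hP
    exact ((LinearMap.shortExact_shortComplexKer hf).hasProjectiveDimensionLT_X₃_iff n this).2
      (ih hker)

/-- If every finite-dimensional module over a finite-dimensional Hopf algebra has projective
dimension at most `n`, then every finite-dimensional module is projective: each module `X` is a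
first syzygy of the cokernel of an embedding of `X` into a free module. -/
lemma HopfAlgebra.projective_of_hasProjectiveDimensionLE {k H : Type} [Field k] [Ring H]
    [HopfAlgebra k H] [FiniteDimensional k H] {n : ℕ}
    (hn : ∀ (M : Type) [AddCommGroup M] [Module k M] [Module H M] [IsScalarTower k H M]
      [FiniteDimensional k M], HasProjectiveDimensionLE (ModuleCat.of H M) n)
    (X : Type) [AddCommGroup X] [Module k X] [Module H X] [IsScalarTower k H X]
    [FiniteDimensional k X] : Module.Projective H X := by
  induction n generalizing X with
  | zero =>
    rw [IsProjective.iff_projective, projective_iff_hasProjectiveDimensionLE_zero]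
    exact hn X
  | succ n ih =>
    refine ih (fun M ↦ ?_) X
    intros
    obtain ⟨f, hf⟩ := HopfAlgebra.exists_injective_to_tensor (k := k) (H := H) M
    have : Module.Projective H (H ⊗[k] M) :=
      .of_basis (Algebra.TensorProduct.basis H (Module.finBasis k M))
    have : Projective (ModuleCat.of H (H ⊗[k] M)) := (IsProjective.iff_projective _).1 this
    have hS := LinearMap.shortExact_shortComplexKer (Submodule.mkQ_surjective (LinearMap.range f))
    have hker := (hS.hasProjectiveDimensionLT_X₃_iff n this).1 (hn _)
    let e : M ≃ₗ[H] LinearMap.ker (LinearMap.range f).mkQ :=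
      LinearEquiv.ofInjective f hf ≪≫ₗ LinearEquiv.ofEq _ _ (Submodule.ker_mkQ _).symm
    exact ModuleCat.hasProjectiveDimensionLE_of_linearEquiv
      (M := ModuleCat.of H (LinearMap.ker (LinearMap.range f).mkQ)) (N := ModuleCat.of H M) e.symm n

theorem stmt18 (k H : Type) [Field k] [Ring H] [HopfAlgebra k H] [FiniteDimensional k H]
    (hfin : ∃ n : ℕ, ∀ (M : Type) [AddCommGroup M] [Module k M] [Module H M]
      [IsScalarTower k H M] [FiniteDimensional k M], ProjDimLE H n M) :
    IsSemisimpleRing H := by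
  obtain ⟨n, hn⟩ := hfin
  refine (isSemisimpleModule_iff H H).2 ⟨fun I ↦ ?_⟩
  have : Module.Projective H (H ⧸ I) :=
    HopfAlgebra.projective_of_hasProjectiveDimensionLE (k := k)
      (fun M ↦ by intros; exact (hn M).hasProjectiveDimensionLE) _
  obtain ⟨s, hs⟩ := Module.projective_lifting_property I.mkQ .id I.mkQ_surjective
  have hs' (x : H ⧸ I) : I.mkQ (s x) = x := LinearMap.congr_fun hs x
  let p : H →ₗ[H] I := (LinearMap.id - s ∘ₗ I.mkQ).codRestrict I fun x ↦ by
    refine (Submodule.Quotient.mk_eq_zero I).1 ?_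
    rw [← I.mkQ_apply, LinearMap.sub_apply, LinearMap.comp_apply, map_sub, hs', LinearMap.id_apply,
      sub_self]
  refine ⟨LinearMap.ker p, LinearMap.isCompl_of_proj fun x ↦ Subtype.ext ?_⟩
  have : I.mkQ x = 0 := by simp
  simp only [p, LinearMap.codRestrict_apply, LinearMap.sub_apply, LinearMap.comp_apply, this,
    map_zero, LinearMap.id_apply, sub_zero]
end
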